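/- Let Y = (0,1)², N a positive integer, h = 1/N, 𝒯_h the uniform triangulation of Y into 2N² triangles obtained by dividing each square [ih,(i+1)h] × [jh,(j+1)h] along the diagonal from (ih,jh) to ((i+1)h,(j+1)h), and for 0 < δ ≤ h let K_δ be the homothety of K ∈ 𝒯_h about its barycenter with ratio δ/h. Let φ^{ij}(x) = max(0, 1 − max(|x₁/h − i|, |x₂/h − j|, |(x₁ − x₂)/h − (i − j)|)) and I = {1,…,N−1}². Let (Ω, ℱ, ℙ) be a probability space, q : ℝ² × Ω → ℝ jointly measurable, uniformly bounded, with E q(x,·) = 0 and E[q(x,·)q(y,·)] = R(x−y) for all x, y ∈ ℝ², with R ∈ L¹(ℝ²). Let q₀ : Y → ℝ be bounded measurable with q₀ ≥ 0 and, for a fixed ε > 0, assume q₀(x) + q(x/ε, ω) ≥ 0 for a.e. x ∈ Y and ℙ-a.e. ω. For integrable Q : Y → ℝ define A^Q_{ij,kl} = Σ_{K ∈ 𝒯_h} (|K|/|K_δ|) ∫_{K_δ} (∇φ^{ij}·∇φ^{kl} + Q φ^{ij} φ^{kl}) dx on I × I; set A^ε(ω) = A^{q₀ + q(·/ε,ω)},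 A⁰ = A^{q₀}. Let f : Y → ℝ be bounded measurable, F_{ij} = ∫_Y f φ^{ij} dx, and let U^ε(ω), U⁰ ∈ ℝ^I solve A^ε(ω) U^ε(ω) = F and A⁰ U⁰ = F; let G = (A⁰)^{−1}. Define d⁻₁(i,j) = (i−1,j), d⁻₂(i,j) = (i,j−1), d⁻₃(i,j) = (i−1,j−1), and for V ∈ ℝ^I set D⁻_s V_{ij} = V_{ij} − V_{d⁻_s ij} with the convention V_{kl} = 0 for kl ∉ I; D⁻_s acts on G in its second index pair. Suppose there exist C > 0 and γ₁, γ₂, γ₃, γ₄ ∈ ℝ (possibly negative) such that almost surely, for all s = 1,2,3 and all ij, kl ∈ I, |D⁻_s G_{ij,kl}| ≤ C h^{γ₁}, |D⁻_s U^ε_{ij}| ≤ C h^{γ₂}, |G_{ij,kl}| ≤ C h^{γ₃} and |U^ε_{ij}| ≤ C h^{γ₄}. Then there is a constant C′ depending only on C (not on h, δ or ε) such that E ‖U^ε − U⁰‖²_{ℓ²} ≤ C′ h^{2 min(γ₁+γ₂, γ₃+γ₄) − 2} ‖R‖_{L¹(ℝ²)} (ε/δ)², where ‖V‖²_{ℓ²}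 = Σ_{ij ∈ I} V_{ij}². -/

import Mathlib

noncomputable section
open MeasureTheory

/-- Closed triangle of the uniform triangulation of the unit square: for
`0 ≤ i, j ≤ N−1`, `tri h i j true` is the lower triangle with vertices
`(ih, jh), ((i+1)h, jh), ((i+1)h, (j+1)h)` and `tri h i j false` the upper triangle
with vertices `(ih, jh), (ih, (j+1)h), ((i+1)h, (j+1)h)`. -/
def tri (h : ℝ) (i j : ℕ) (lower : Bool) : Set (ℝ × ℝ) :=
  if lower then
    convexHull ℝ {((i * h, j * h) : ℝ × ℝ), ((i + 1) * h, j * h), ((i + 1) * h, (j + 1) * h)}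
  else
    convexHull ℝ {((i * h, j * h) : ℝ × ℝ), (i * h, (j + 1) * h), ((i + 1) * h, (j + 1) * h)}

/-- The barycenter of the triangle `tri h i j lower`. -/
def bary (h : ℝ) (i j : ℕ) (lower : Bool) : ℝ × ℝ :=
  if lower then ((3 * i + 2) / 3 * h, (3 * j + 1) / 3 * h)
  else ((3 * i + 1) / 3 * h, (3 * j + 2) / 3 * h)

/-- The patch `K_δ`: the image of the triangle `K = tri h i j lower` under the
homothety with center the barycenter of `K` and ratio `δ/h`. -/
def patch (h δ : ℝ) (i j : ℕ) (lower : Bool) : Set (ℝ × ℝ) :=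
  (AffineMap.homothety (bary h i j lower) (δ / h)) '' (tri h i j lower)

/-- The P1 hat (nodal basis) function at the node `(i h, j h)`. -/
def hat (h : ℝ) (p : ℤ × ℤ) (x : ℝ × ℝ) : ℝ :=
  max 0 (1 - max |x.1 / h - (p.1 : ℝ)|
    (max |x.2 / h - (p.2 : ℝ)| |(x.1 - x.2) / h - ((p.1 : ℝ) - (p.2 : ℝ))|))

/-- Dot product of the gradients of two functions (via the Fréchet derivative; for
piecewise affine functions this is the piecewise constant gradient a.e.). -/
def gradDot (f g : ℝ × ℝ → ℝ) (x : ℝ × ℝ) : ℝ :=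
  fderiv ℝ f x (1, 0) * fderiv ℝ g x (1, 0) + fderiv ℝ f x (0, 1) * fderiv ℝ g x (0, 1)

/-- The HMM stiffness matrix with potential `Q`:
`A^Q_{p,r} = Σ_{K ∈ 𝒯_h} (|K|/|K_δ|) ∫_{K_δ} (∇φ^p·∇φ^r + Q φ^p φ^r)`. -/
def stiff (h δ : ℝ) (N : ℕ) (Q : ℝ × ℝ → ℝ) (p r : ℤ × ℤ) : ℝ :=
  ∑ t : Fin N × Fin N × Bool,
    (volume (tri h t.1 t.2.1 t.2.2)).toReal / (volume (patch h δ t.1 t.2.1 t.2.2)).toReal *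
      ∫ x in patch h δ t.1 t.2.1 t.2.2,
        (gradDot (hat h p) (hat h r) x + Q x * hat h p x * hat h r x)

/-- The interior nodes `I = {1, …, N−1}²`. -/
def nodes (N : ℕ) : Finset (ℤ × ℤ) := Finset.Icc 1 ((N : ℤ) - 1) ×ˢ Finset.Icc 1 ((N : ℤ) - 1)

/-- Backward neighbor maps `d^-_s`, `s = 1, 2, 3` (horizontal, vertical, diagonal). -/
def dm (s : Fin 3) (p : ℤ × ℤ) : ℤ × ℤ :=
  if s = 0 then (p.1 - 1, p.2) else if s = 1 then (p.1, p.2 - 1) else (p.1 - 1, p.2 - 1)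

/-- The unit square `Y = (0,1)²`. -/
def Ysq : Set (ℝ × ℝ) := Set.Ioo (0 : ℝ) 1 ×ˢ Set.Ioo (0 : ℝ) 1

/-- The load vector `F_{ij} = ∫_Y f φ^{ij}`. -/
def load (h : ℝ) (f : ℝ × ℝ → ℝ) (p : ℤ × ℤ) : ℝ := ∫ x in Ysq, f x * hat h p x

/-- Second moment of an oscillatory integral: the mean square of `∫_P q(x/ε) ψ(x) dx` with
`|ψ| ≤ 1` is at most `|P| ε² ‖R‖_{L¹}`. -/
lemma integral_sq_setIntegral_le {Ω : Type} [MeasureSpace Ω]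
    [IsProbabilityMeasure (volume : Measure Ω)] {q : ℝ × ℝ → Ω → ℝ} {R : ℝ × ℝ → ℝ} {M : ℝ}
    (hq : Measurable (fun p : (ℝ × ℝ) × Ω => q p.1 p.2)) (hM : ∀ x ω, |q x ω| ≤ M)
    (hR : ∀ x y : ℝ × ℝ, ∫ ω, q x ω * q y ω = R (x - y)) (hRi : Integrable R)
    {P : Set (ℝ × ℝ)} (hP : volume P ≠ ⊤) {ψ : ℝ × ℝ → ℝ} (hψ : Measurable ψ)
    (hψ1 : ∀ x, |ψ x| ≤ 1) {ε : ℝ} (hε : 0 < ε) :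
    ∫ ω, (∫ x in P, q (ε⁻¹ • x) ω * ψ x) ^ 2 ≤ (volume P).toReal * (ε ^ 2 * ∫ z, |R z|) := by
  have : IsFiniteMeasure (volume.restrict P : Measure (ℝ × ℝ)) := ⟨by simpa using hP.lt_top⟩
  have hscale : ∀ x, Integrable (fun y : ℝ × ℝ => |R (ε⁻¹ • x - ε⁻¹ • y)|) := fun x => by
    have := ((hRi.abs.comp_smul (inv_ne_zero hε.ne')).comp_sub_left x)
    simpa only [smul_sub] using this
  have hscale_eq : ∀ x, ∫ y : ℝ × ℝ, |R (ε⁻¹ • x - ε⁻¹ • y)| = ε ^ 2 * ∫ z, |R z| := fun x => by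
    have h1 := integral_sub_left_eq_self (fun z : ℝ × ℝ => |R (ε⁻¹ • z)|) volume x
    simp only [smul_sub] at h1
    rw [h1, Measure.integral_comp_smul volume (fun z : ℝ × ℝ => |R z|)]
    simp [abs_of_pos hε]
  have hFm : Measurable (fun p : Ω × (ℝ × ℝ) × (ℝ × ℝ) =>
      (q (ε⁻¹ • p.2.1) p.1 * ψ p.2.1) * (q (ε⁻¹ • p.2.2) p.1 * ψ p.2.2)) := by
    have h1 : Measurable (fun p : Ω × (ℝ × ℝ) × (ℝ × ℝ) => q (ε⁻¹ • p.2.1) p.1) :=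
      hq.comp (f := fun p : Ω × (ℝ × ℝ) × (ℝ × ℝ) => (ε⁻¹ • p.2.1, p.1)) (by fun_prop)
    have h2 : Measurable (fun p : Ω × (ℝ × ℝ) × (ℝ × ℝ) => q (ε⁻¹ • p.2.2) p.1) :=
      hq.comp (f := fun p : Ω × (ℝ × ℝ) × (ℝ × ℝ) => (ε⁻¹ • p.2.2, p.1)) (by fun_prop)
    fun_prop
  have hbd : ∀ x ω, |q (ε⁻¹ • x) ω * ψ x| ≤ M := fun x ω => by
    rw [abs_mul]
    exact (mul_le_of_le_one_right (abs_nonneg _) (hψ1 x)).trans (hM _ ω)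
  have hFi : Integrable (fun p : Ω × (ℝ × ℝ) × (ℝ × ℝ) =>
      (q (ε⁻¹ • p.2.1) p.1 * ψ p.2.1) * (q (ε⁻¹ • p.2.2) p.1 * ψ p.2.2))
      ((volume : Measure Ω).prod ((volume.restrict P).prod (volume.restrict P))) := by
    refine Integrable.of_bound hFm.aestronglyMeasurable (M * M) (ae_of_all _ fun p => ?_)
    rw [Real.norm_eq_abs, abs_mul]
    exact mul_le_mul (hbd _ _) (hbd _ _) (abs_nonneg _) ((abs_nonneg _).trans (hbd p.2.1 p.1))
  have hin : ∀ z : (ℝ × ℝ) × (ℝ × ℝ),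
      ∫ ω, (q (ε⁻¹ • z.1) ω * ψ z.1) * (q (ε⁻¹ • z.2) ω * ψ z.2)
        = ψ z.1 * ψ z.2 * R (ε⁻¹ • z.1 - ε⁻¹ • z.2) := fun z => by
    rw [← hR, ← integral_const_mul]
    exact integral_congr_ae (ae_of_all _ fun ω => by ring)
  have hHi : Integrable (fun z : (ℝ × ℝ) × (ℝ × ℝ) =>
      ψ z.1 * ψ z.2 * R (ε⁻¹ • z.1 - ε⁻¹ • z.2))
      ((volume.restrict P).prod (volume.restrict P)) := by
    simpa only [hin] using hFi.integral_prod_right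
  calc ∫ ω, (∫ x in P, q (ε⁻¹ • x) ω * ψ x) ^ 2
      = ∫ ω, ∫ z, (q (ε⁻¹ • z.1) ω * ψ z.1) * (q (ε⁻¹ • z.2) ω * ψ z.2)
          ∂((volume.restrict P).prod (volume.restrict P)) := by
        refine integral_congr_ae (ae_of_all _ fun ω => ?_)
        simp only [sq]
        exact (integral_prod_mul (fun x => q (ε⁻¹ • x) ω * ψ x)
          (fun x => q (ε⁻¹ • x) ω * ψ x)).symm
    _ = ∫ z, ψ z.1 * ψ z.2 * R (ε⁻¹ • z.1 - ε⁻¹ • z.2)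
          ∂((volume.restrict P).prod (volume.restrict P)) := by
        rw [integral_integral_swap hFi]
        exact integral_congr_ae (ae_of_all _ hin)
    _ = ∫ x in P, ∫ y in P, ψ x * ψ y * R (ε⁻¹ • x - ε⁻¹ • y) := integral_prod _ hHi
    _ ≤ ∫ _ in P, ε ^ 2 * ∫ z, |R z| := by
        refine integral_mono hHi.integral_prod_left (integrable_const _) fun x => ?_
        rw [← hscale_eq x]
        refine (le_abs_self _).trans (abs_integral_le_integral_abs.trans ?_)
        refine (integral_mono_of_nonneg (ae_of_all _ fun y => abs_nonneg _)
          (hscale x).integrableOn (ae_of_all _ fun y => ?_)).trans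
          (setIntegral_le_integral (hscale x) (ae_of_all _ fun y => abs_nonneg _))
        simp only [abs_mul]
        exact mul_le_of_le_one_left (abs_nonneg _)
          (mul_le_one₀ (hψ1 x) (abs_nonneg _) (hψ1 y))
    _ = (volume P).toReal * (ε ^ 2 * ∫ z, |R z|) := by
        simp [Measure.real]

/-- Adding a bounded perturbation `b` to `g + a` changes the integral by at most `|∫ b|`,
even if `g` is not integrable. -/
lemma abs_integral_add_sub_le {α : Type*} [MeasurableSpace α] {μ : Measure α} {g a b : α → ℝ}
    (ha : Integrable a μ) (hb : Integrable b μ) :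
    |∫ x, (g x + (a x + b x)) ∂μ - ∫ x, (g x + a x) ∂μ| ≤ |∫ x, b x ∂μ| := by
  by_cases hg : Integrable g μ
  · have h1 : ∫ x, (g x + (a x + b x)) ∂μ = ∫ x, g x ∂μ + ∫ x, (a x + b x) ∂μ :=
      integral_add hg (ha.add hb)
    rw [h1, integral_add ha hb, integral_add hg ha]
    exact (congrArg abs (by ring)).le
  · have h1 : ¬ Integrable (fun x => g x + (a x + b x)) μ := fun h =>
      hg ((integrable_add_iff_integrable_left (ha.add hb)).1 h)
    have h2 : ¬ Integrable (fun x => g x + a x) μ := fun h =>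
      hg ((integrable_add_iff_integrable_left ha).1 h)
    rw [integral_undef h1, integral_undef h2]
    simp

/-- The closed mesh square with lower left corner `(ih, jh)`. -/
def cell (h : ℝ) (i j : ℕ) : Set (ℝ × ℝ) :=
  Set.Icc (i * h) ((i + 1) * h) ×ˢ Set.Icc (j * h) ((j + 1) * h)

lemma tri_subset_cell {h : ℝ} (hh : 0 < h) (i j : ℕ) (b : Bool) : tri h i j b ⊆ cell h i j := by
  have hc : Convex ℝ (cell h i j) := (convex_Icc _ _).prod (convex_Icc _ _)
  cases b <;> simp only [tri, Bool.false_eq_true, if_true, if_false] <;>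
    refine convexHull_min ?_ hc <;>
    · rintro x (rfl | rfl | rfl) <;>
        simp only [cell, Set.mem_prod, Set.mem_Icc] <;> refine ⟨⟨?_, ?_⟩, ?_, ?_⟩ <;> nlinarith

lemma bary_mem_cell {h : ℝ} (hh : 0 < h) (i j : ℕ) (b : Bool) : bary h i j b ∈ cell h i j := by
  cases b <;> simp only [bary, cell, Bool.false_eq_true, if_true, if_false, Set.mem_prod,
    Set.mem_Icc] <;> refine ⟨⟨?_, ?_⟩, ?_, ?_⟩ <;> nlinarith

lemma patch_subset_cell {h δ : ℝ} (hh : 0 < h) (hδ : 0 < δ) (hδh : δ ≤ h) (i j : ℕ) (b : Bool) :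
    patch h δ i j b ⊆ cell h i j := by
  have hc : Convex ℝ (cell h i j) := (convex_Icc _ _).prod (convex_Icc _ _)
  rintro _ ⟨y, hy, rfl⟩
  rw [AffineMap.homothety_eq_lineMap]
  exact hc.lineMap_mem (bary_mem_cell hh i j b) (tri_subset_cell hh i j b hy)
    ⟨by positivity, (div_le_one hh).2 hδh⟩

lemma volume_cell {h : ℝ} (i j : ℕ) :
    volume (cell h i j) = ENNReal.ofReal h * ENNReal.ofReal h := by
  rw [cell, Measure.volume_eq_prod, Measure.prod_prod, Real.volume_Icc, Real.volume_Icc]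
  ring_nf

lemma volume_patch_ne_top {h δ : ℝ} (hh : 0 < h) (hδ : 0 < δ) (hδh : δ ≤ h) (i j : ℕ) (b : Bool) :
    volume (patch h δ i j b) ≠ ⊤ :=
  measure_ne_top_of_subset (patch_subset_cell hh hδ hδh i j b)
    (by rw [volume_cell]; exact ENNReal.mul_ne_top ENNReal.ofReal_ne_top ENNReal.ofReal_ne_top)

lemma volume_ratio_sq_mul_le {h δ : ℝ} (hh : 0 < h) (hδ : 0 < δ) (i j : ℕ) (b : Bool) :
    ((volume (tri h i j b)).toReal / (volume (patch h δ i j b)).toReal) ^ 2 *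
      (volume (patch h δ i j b)).toReal ≤ h ^ 4 / δ ^ 2 := by
  have hv : (volume (patch h δ i j b)).toReal = (δ / h) ^ 2 * (volume (tri h i j b)).toReal := by
    rw [patch, Measure.addHaar_image_homothety]
    have h2 : 0 ≤ (δ / h) ^ 2 := by positivity
    simp [ENNReal.toReal_mul, h2]
  have hle : (volume (tri h i j b)).toReal ≤ h ^ 2 := by
    have h1 := measure_mono (μ := volume) (tri_subset_cell hh i j b)
    rw [volume_cell, ← ENNReal.ofReal_mul hh.le] at h1
    rw [sq]
    exact ENNReal.toReal_le_of_le_ofReal (by positivity) h1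
  rw [hv]
  rcases (ENNReal.toReal_nonneg (a := volume (tri h i j b))).eq_or_lt with h0 | h0
  · rw [← h0]; simp; positivity
  · have : ((volume (tri h i j b)).toReal / ((δ / h) ^ 2 * (volume (tri h i j b)).toReal)) ^ 2 *
        ((δ / h) ^ 2 * (volume (tri h i j b)).toReal)
        = (volume (tri h i j b)).toReal * (h ^ 2 / δ ^ 2) := by
      field_simp
    rw [this]
    calc _ ≤ h ^ 2 * (h ^ 2 / δ ^ 2) := by gcongr
      _ = _ := by ring

lemma measurable_hat (h : ℝ) (p : ℤ × ℤ) : Measurable (hat h p) := by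
  unfold hat
  simp only [← Real.norm_eq_abs]
  fun_prop

lemma hat_nonneg (h : ℝ) (p : ℤ × ℤ) (x : ℝ × ℝ) : 0 ≤ hat h p x := le_max_left _ _

lemma hat_le_one (h : ℝ) (p : ℤ × ℤ) (x : ℝ × ℝ) : hat h p x ≤ 1 :=
  max_le zero_le_one (sub_le_self _ ((abs_nonneg _).trans (le_max_left _ _)))

lemma abs_hat_mul_hat_le_one (h : ℝ) (p r : ℤ × ℤ) (x : ℝ × ℝ) : |hat h p x * hat h r x| ≤ 1 := by
  rw [abs_of_nonneg (mul_nonneg (hat_nonneg _ _ _) (hat_nonneg _ _ _))]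
  exact mul_le_one₀ (hat_le_one _ _ _) (hat_nonneg _ _ _) (hat_le_one _ _ _)

/-- The four nodes at the corners of `cell h i j`. -/
def corners (i j : ℕ) : Finset (ℤ × ℤ) :=
  Finset.Icc (i : ℤ) (i + 1) ×ˢ Finset.Icc (j : ℤ) (j + 1)

lemma card_corners (i j : ℕ) : (corners i j).card = 4 := by
  simp [corners, Finset.card_product, add_assoc, add_sub_cancel_left]

lemma hat_eq_zero {h : ℝ} (hh : 0 < h) {i j : ℕ} {p : ℤ × ℤ} (hp : p ∉ corners i j)
    {x : ℝ × ℝ} (hx : x ∈ cell h i j) : hat h p x = 0 := by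
  obtain ⟨⟨h1, h2⟩, h3, h4⟩ := hx
  rw [← le_div_iff₀ hh] at h1 h3
  rw [← div_le_iff₀ hh] at h2 h4
  have key : ∀ {n : ℕ} {m : ℤ} {y : ℝ}, (n : ℝ) ≤ y → y ≤ n + 1 → |y - m| < 1 →
      (n : ℤ) ≤ m ∧ m ≤ n + 1 := fun {n m y} ha hb hc => by
    rw [abs_lt] at hc
    have e1 : ((n : ℤ) : ℝ) < ((m + 1 : ℤ) : ℝ) := by push_cast; linarith
    have e2 : (m : ℝ) < ((n + 2 : ℤ) : ℝ) := by push_cast; linarith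
    have e1' := Int.cast_lt.1 e1
    have e2' := Int.cast_lt.1 e2
    omega
  refine max_eq_left (sub_nonpos.2 ?_)
  by_contra! hlt
  obtain ⟨ha, hb⟩ := max_lt_iff.1 hlt
  refine hp ?_
  simp only [corners, Finset.mem_product, Finset.mem_Icc]
  exact ⟨key h1 h2 ha, key h3 h4 (max_lt_iff.1 hb).1⟩

/-- The weight `|K| / |K_δ|`. -/
def ratio (h δ : ℝ) {N : ℕ} (t : Fin N × Fin N × Bool) : ℝ :=
  (volume (tri h t.1 t.2.1 t.2.2)).toReal / (volume (patch h δ t.1 t.2.1 t.2.2)).toReal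

/-- The weighted local mass term `(|K| / |K_δ|) ∫_{K_δ} v φ^p φ^r`. -/
def localMass (h δ : ℝ) {N : ℕ} (v : ℝ × ℝ → ℝ) (t : Fin N × Fin N × Bool) (p r : ℤ × ℤ) : ℝ :=
  ratio h δ t * ∫ x in patch h δ t.1 t.2.1 t.2.2, v x * (hat h p x * hat h r x)

lemma ratio_nonneg (h δ : ℝ) {N : ℕ} (t : Fin N × Fin N × Bool) : 0 ≤ ratio h δ t :=
  div_nonneg ENNReal.toReal_nonneg ENNReal.toReal_nonneg

lemma integrableOn_patch_of_bounded {h δ : ℝ} (hh : 0 < h) (hδ : 0 < δ) (hδh : δ ≤ h)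
    {i j : ℕ} {b : Bool} {v : ℝ × ℝ → ℝ} (hv : Measurable v) {B : ℝ} (hB : ∀ x, |v x| ≤ B)
    (p r : ℤ × ℤ) :
    IntegrableOn (fun x => v x * (hat h p x * hat h r x)) (patch h δ i j b) := by
  have : IsFiniteMeasure (volume.restrict (patch h δ i j b)) :=
    ⟨by simpa using (volume_patch_ne_top hh hδ hδh i j b).lt_top⟩
  refine Integrable.of_bound
    (hv.mul ((measurable_hat h p).mul (measurable_hat h r))).aestronglyMeasurable B
    (ae_of_all _ fun x => ?_)
  rw [Real.norm_eq_abs, abs_mul]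
  exact (mul_le_of_le_one_right (abs_nonneg _) (abs_hat_mul_hat_le_one h p r x)).trans (hB x)

lemma abs_stiff_add_sub_stiff_le {h δ : ℝ} (hh : 0 < h) (hδ : 0 < δ) (hδh : δ ≤ h) (N : ℕ)
    {q₀ v : ℝ × ℝ → ℝ} (hq₀ : Measurable q₀) (hv : Measurable v) {B₀ B : ℝ}
    (hB₀ : ∀ x, |q₀ x| ≤ B₀) (hB : ∀ x, |v x| ≤ B) (p r : ℤ × ℤ) :
    |stiff h δ N (fun x => q₀ x + v x) p r - stiff h δ N q₀ p r| ≤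
      ∑ t : Fin N × Fin N × Bool, |localMass h δ v t p r| := by
  simp only [stiff, ← Finset.sum_sub_distrib, ← mul_sub]
  refine (Finset.abs_sum_le_sum_abs _ _).trans (Finset.sum_le_sum fun t _ => ?_)
  rw [localMass, abs_mul, abs_mul]
  refine mul_le_mul_of_nonneg_left ?_ (abs_nonneg _)
  simp only [mul_assoc, add_mul]
  exact abs_integral_add_sub_le
    (integrableOn_patch_of_bounded hh hδ hδh hq₀ hB₀ p r)
    (integrableOn_patch_of_bounded hh hδ hδh hv hB p r)

lemma localMass_eq_zero {h δ : ℝ} (hh : 0 < h) (hδ : 0 < δ) (hδh : δ ≤ h) {N : ℕ}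
    (v : ℝ × ℝ → ℝ) (t : Fin N × Fin N × Bool) {p r : ℤ × ℤ}
    (hpr : (p, r) ∉ corners t.1 t.2.1 ×ˢ corners t.1 t.2.1) : localMass h δ v t p r = 0 := by
  rw [localMass, setIntegral_eq_zero_of_forall_eq_zero, mul_zero]
  intro x hx
  have hx' := patch_subset_cell hh hδ hδh _ _ _ hx
  rw [Finset.mem_product, not_and_or] at hpr
  rcases hpr with hp | hr
  · rw [hat_eq_zero hh hp hx', zero_mul, mul_zero]
  · rw [hat_eq_zero hh hr hx', mul_zero, mul_zero]

/-- The matrix entries of the perturbation are supported near the diagonal: their absolute sum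
is controlled by the local masses at corner pairs. -/
lemma sum_nodes_abs_localMass_le {h δ : ℝ} (hh : 0 < h) (hδ : 0 < δ) (hδh : δ ≤ h) {N : ℕ}
    (v : ℝ × ℝ → ℝ) (t : Fin N × Fin N × Bool) (S : Finset (ℤ × ℤ)) :
    ∑ z ∈ S ×ˢ S, |localMass h δ v t z.1 z.2| ≤
      ∑ z ∈ corners t.1 t.2.1 ×ˢ corners t.1 t.2.1, |localMass h δ v t z.1 z.2| := by
  classical
  rw [← Finset.sum_filter_add_sum_filter_not (S ×ˢ S)
    (fun z => z ∈ corners t.1 t.2.1 ×ˢ corners t.1 t.2.1)]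
  have hout : ∑ z ∈ (S ×ˢ S).filter (fun z => z ∉ corners t.1 t.2.1 ×ˢ corners t.1 t.2.1),
      |localMass h δ v t z.1 z.2| = 0 := Finset.sum_eq_zero fun z hz => by
    rw [localMass_eq_zero hh hδ hδh v t (Finset.mem_filter.1 hz).2, abs_zero]
  rw [hout, add_zero]
  exact Finset.sum_le_sum_of_subset_of_nonneg (fun z hz => (Finset.mem_filter.1 hz).2)
    fun _ _ _ => abs_nonneg _

/-- Sum of squared local masses over all triangles and corner pairs. -/
def massSq (h δ : ℝ) (N : ℕ) (v : ℝ × ℝ → ℝ) : ℝ :=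
  ∑ t : Fin N × Fin N × Bool,
    ∑ z ∈ corners t.1 t.2.1 ×ˢ corners t.1 t.2.1, localMass h δ v t z.1 z.2 ^ 2

lemma sq_sum_abs_localMass_le (h δ : ℝ) (N : ℕ) (v : ℝ × ℝ → ℝ) :
    (∑ t : Fin N × Fin N × Bool,
      ∑ z ∈ corners t.1 t.2.1 ×ˢ corners t.1 t.2.1, |localMass h δ v t z.1 z.2|) ^ 2 ≤
      32 * (N : ℝ) ^ 2 * massSq h δ N v := by
  rw [massSq]
  refine sq_sum_le_card_mul_sum_sq.trans ?_
  have hc : ((Finset.univ : Finset (Fin N × Fin N × Bool)).card : ℝ) = 2 * (N : ℝ) ^ 2 := by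
    simp; ring
  rw [hc]
  have : ∀ t : Fin N × Fin N × Bool,
      (∑ z ∈ corners t.1 t.2.1 ×ˢ corners t.1 t.2.1, |localMass h δ v t z.1 z.2|) ^ 2 ≤
      16 * ∑ z ∈ corners t.1 t.2.1 ×ˢ corners t.1 t.2.1, localMass h δ v t z.1 z.2 ^ 2 := by
    intro t
    refine sq_sum_le_card_mul_sum_sq.trans_eq ?_
    simp only [sq_abs, Finset.card_product, card_corners]
    norm_num
  calc _ ≤ 2 * (N : ℝ) ^ 2 * ∑ t : Fin N × Fin N × Bool,
      16 * ∑ z ∈ corners t.1 t.2.1 ×ˢ corners t.1 t.2.1, localMass h δ v t z.1 z.2 ^ 2 := by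
        gcongr with t
        exact this t
    _ = _ := by rw [← Finset.mul_sum]; ring

/-- The discrete resolvent identity `U^ε - U⁰ = -G (A^ε - A⁰) U^ε`. -/
lemma sub_eq_neg_sum_of_leftInverse {ι : Type*} [DecidableEq ι] {S : Finset ι}
    {A B G : ι → ι → ℝ} {U V F : ι → ℝ}
    (hA : ∀ i ∈ S, ∑ k ∈ S, A i k * U k = F i) (hB : ∀ i ∈ S, ∑ k ∈ S, B i k * V k = F i)
    (hG : ∀ i ∈ S, ∀ m ∈ S, ∑ k ∈ S, G i k * B k m = if i = m then 1 else 0)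
    {i : ι} (hi : i ∈ S) :
    U i - V i = - ∑ z ∈ S ×ˢ S, G i z.1 * (A z.1 z.2 - B z.1 z.2) * U z.2 := by
  have hinv : ∀ W : ι → ℝ, ∑ k ∈ S, G i k * ∑ m ∈ S, B k m * W m = W i := fun W => by
    simp only [Finset.mul_sum, ← mul_assoc]
    rw [Finset.sum_comm]
    simp only [← Finset.sum_mul]
    rw [Finset.sum_congr rfl fun m hm => by rw [hG i hi m hm]]
    simp [hi]
  rw [Finset.sum_product]
  simp only [mul_sub, sub_mul, Finset.sum_sub_distrib, mul_assoc, ← Finset.mul_sum]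
  rw [hinv U, Finset.sum_congr rfl fun k hk => by rw [hA k hk, ← hB k hk], hinv V]
  ring

/-- Pointwise control of the squared corrector by the local masses of the perturbation. -/
lemma sq_sub_le_massSq {h δ : ℝ} (hh : 0 < h) (hδ : 0 < δ) (hδh : δ ≤ h) (N : ℕ)
    {q₀ v : ℝ × ℝ → ℝ} (hq₀ : Measurable q₀) (hv : Measurable v) {B₀ B : ℝ}
    (hB₀ : ∀ x, |q₀ x| ≤ B₀) (hB : ∀ x, |v x| ≤ B) {U V F : ℤ × ℤ → ℝ} {G : ℤ × ℤ → ℤ × ℤ → ℝ}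
    (hU : ∀ i ∈ nodes N, ∑ k ∈ nodes N, stiff h δ N (fun x => q₀ x + v x) i k * U k = F i)
    (hV : ∀ i ∈ nodes N, ∑ k ∈ nodes N, stiff h δ N q₀ i k * V k = F i)
    (hG : ∀ i ∈ nodes N, ∀ m ∈ nodes N,
      ∑ k ∈ nodes N, G i k * stiff h δ N q₀ k m = if i = m then 1 else 0)
    {g u : ℝ} (hg : ∀ i ∈ nodes N, ∀ k ∈ nodes N, |G i k| ≤ g)
    (hu : ∀ i ∈ nodes N, |U i| ≤ u) {i : ℤ × ℤ} (hi : i ∈ nodes N) :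
    (U i - V i) ^ 2 ≤ (g * u) ^ 2 * (32 * (N : ℝ) ^ 2 * massSq h δ N v) := by
  have hg0 : 0 ≤ g := (abs_nonneg _).trans (hg i hi i hi)
  have hu0 : 0 ≤ u := (abs_nonneg _).trans (hu i hi)
  have habs : |U i - V i| ≤ g * u * ∑ t : Fin N × Fin N × Bool,
      ∑ z ∈ corners t.1 t.2.1 ×ˢ corners t.1 t.2.1, |localMass h δ v t z.1 z.2| := by
    rw [sub_eq_neg_sum_of_leftInverse hU hV hG hi, abs_neg]
    calc _ ≤ ∑ z ∈ nodes N ×ˢ nodes N, g * u *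
          ∑ t : Fin N × Fin N × Bool, |localMass h δ v t z.1 z.2| := by
          refine (Finset.abs_sum_le_sum_abs _ _).trans (Finset.sum_le_sum fun z hz => ?_)
          obtain ⟨h1, h2⟩ := Finset.mem_product.1 hz
          have h3 := abs_stiff_add_sub_stiff_le hh hδ hδh N hq₀ hv hB₀ hB z.1 z.2
          rw [abs_mul, abs_mul, mul_right_comm]
          exact mul_le_mul (mul_le_mul (hg i hi _ h1) (hu _ h2) (abs_nonneg _) hg0) h3
            (abs_nonneg _) (by positivity)
      _ ≤ _ := by
          rw [← Finset.mul_sum, Finset.sum_comm]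
          refine mul_le_mul_of_nonneg_left (Finset.sum_le_sum fun t _ => ?_) (by positivity)
          exact sum_nodes_abs_localMass_le hh hδ hδh v t _
  rw [← sq_abs]
  calc |U i - V i| ^ 2 ≤ (g * u * _) ^ 2 := by gcongr
    _ ≤ _ := by
      rw [mul_pow]
      gcongr
      exact sq_sum_abs_localMass_le h δ N v

lemma measurable_localMass {Ω : Type} [MeasurableSpace Ω] {q : ℝ × ℝ → Ω → ℝ}
    (hq : Measurable (fun p : (ℝ × ℝ) × Ω => q p.1 p.2)) (h δ ε : ℝ) {N : ℕ}
    (t : Fin N × Fin N × Bool) (p r : ℤ × ℤ) :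
    Measurable fun ω => localMass h δ (fun x => q (ε⁻¹ • x) ω) t p r := by
  have hm : Measurable (fun z : Ω × (ℝ × ℝ) => q (ε⁻¹ • z.2) z.1 * (hat h p z.2 * hat h r z.2)) :=
    (hq.comp (f := fun z : Ω × (ℝ × ℝ) => (ε⁻¹ • z.2, z.1)) (by fun_prop)).mul
      (((measurable_hat h p).comp measurable_snd).mul ((measurable_hat h r).comp measurable_snd))
  exact (hm.stronglyMeasurable.integral_prod_right
    (ν := volume.restrict (patch h δ t.1 t.2.1 t.2.2))).measurable.const_mul _

section

variable {Ω : Type} [MeasureSpace Ω] [IsProbabilityMeasure (volume : Measure Ω)]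
  {q : ℝ × ℝ → Ω → ℝ} {R : ℝ × ℝ → ℝ} {M h δ ε : ℝ}

lemma integrable_localMass_sq (hq : Measurable (fun p : (ℝ × ℝ) × Ω => q p.1 p.2))
    (hM : ∀ x ω, |q x ω| ≤ M) (hh : 0 < h) (hδ : 0 < δ) (hδh : δ ≤ h) {N : ℕ}
    (t : Fin N × Fin N × Bool) (p r : ℤ × ℤ) :
    Integrable fun ω => localMass h δ (fun x => q (ε⁻¹ • x) ω) t p r ^ 2 := by
  refine Integrable.of_bound
    ((measurable_localMass hq h δ ε t p r).pow_const 2).aestronglyMeasurable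
    ((ratio h δ t * (M * (volume (patch h δ t.1 t.2.1 t.2.2)).toReal)) ^ 2)
    (ae_of_all _ fun ω => ?_)
  rw [Real.norm_eq_abs, abs_pow, localMass, abs_mul, abs_of_nonneg (ratio_nonneg h δ t)]
  have hr := ratio_nonneg h δ t
  gcongr
  rw [← Real.norm_eq_abs]
  refine norm_setIntegral_le_of_norm_le_const
    (volume_patch_ne_top hh hδ hδh _ _ _).lt_top fun x _ => ?_
  rw [Real.norm_eq_abs, abs_mul]
  exact (mul_le_of_le_one_right (abs_nonneg _) (abs_hat_mul_hat_le_one h p r x)).trans (hM _ ω)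

lemma integral_localMass_sq_le (hq : Measurable (fun p : (ℝ × ℝ) × Ω => q p.1 p.2))
    (hM : ∀ x ω, |q x ω| ≤ M) (hR : ∀ x y : ℝ × ℝ, ∫ ω, q x ω * q y ω = R (x - y))
    (hRi : Integrable R) (hh : 0 < h) (hδ : 0 < δ) (hδh : δ ≤ h) (hε : 0 < ε) {N : ℕ}
    (t : Fin N × Fin N × Bool) (p r : ℤ × ℤ) :
    ∫ ω, localMass h δ (fun x => q (ε⁻¹ • x) ω) t p r ^ 2 ≤
      h ^ 4 * (∫ z, |R z|) * (ε / δ) ^ 2 := by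
  simp only [localMass, mul_pow]
  rw [integral_const_mul]
  have hR0 : 0 ≤ ∫ z, |R z| := integral_nonneg fun _ => abs_nonneg _
  calc _ ≤ ratio h δ t ^ 2 *
        ((volume (patch h δ t.1 t.2.1 t.2.2)).toReal * (ε ^ 2 * ∫ z, |R z|)) := by
        gcongr
        exact integral_sq_setIntegral_le hq hM hR hRi (volume_patch_ne_top hh hδ hδh _ _ _)
          ((measurable_hat h p).mul (measurable_hat h r)) (abs_hat_mul_hat_le_one h p r) hε
    _ = ratio h δ t ^ 2 * (volume (patch h δ t.1 t.2.1 t.2.2)).toReal *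
        (ε ^ 2 * ∫ z, |R z|) := by ring
    _ ≤ h ^ 4 / δ ^ 2 * (ε ^ 2 * ∫ z, |R z|) := by
        gcongr
        exact volume_ratio_sq_mul_le hh hδ _ _ _
    _ = _ := by ring

lemma integrable_massSq (hq : Measurable (fun p : (ℝ × ℝ) × Ω => q p.1 p.2))
    (hM : ∀ x ω, |q x ω| ≤ M) (hh : 0 < h) (hδ : 0 < δ) (hδh : δ ≤ h) (N : ℕ) :
    Integrable fun ω => massSq h δ N (fun x => q (ε⁻¹ • x) ω) :=
  integrable_finsetSum _ fun t _ => integrable_finsetSum _ fun z _ =>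
    integrable_localMass_sq hq hM hh hδ hδh t z.1 z.2

lemma integral_massSq_le (hq : Measurable (fun p : (ℝ × ℝ) × Ω => q p.1 p.2))
    (hM : ∀ x ω, |q x ω| ≤ M) (hR : ∀ x y : ℝ × ℝ, ∫ ω, q x ω * q y ω = R (x - y))
    (hRi : Integrable R) (hh : 0 < h) (hδ : 0 < δ) (hδh : δ ≤ h) (hε : 0 < ε) (N : ℕ) :
    ∫ ω, massSq h δ N (fun x => q (ε⁻¹ • x) ω) ≤
      32 * (N : ℝ) ^ 2 * (h ^ 4 * (∫ z, |R z|) * (ε / δ) ^ 2) := by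
  have hi := integrable_localMass_sq (ε := ε) hq hM hh hδ hδh (N := N)
  simp only [massSq]
  rw [integral_finsetSum _ fun t _ => integrable_finsetSum _ fun z _ => hi t z.1 z.2]
  calc _ ≤ ∑ t : Fin N × Fin N × Bool, 16 * (h ^ 4 * (∫ z, |R z|) * (ε / δ) ^ 2) := by
        refine Finset.sum_le_sum fun t _ => ?_
        rw [integral_finsetSum _ fun z _ => hi t z.1 z.2]
        refine (Finset.sum_le_card_nsmul _ _ _ fun z _ =>
          integral_localMass_sq_le hq hM hR hRi hh hδ hδh hε t z.1 z.2).trans_eq ?_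
        simp [Finset.card_product, card_corners]
    _ = _ := by simp; ring

end

lemma card_nodes_le (N : ℕ) : ((nodes N).card : ℝ) ≤ (N : ℝ) ^ 2 := by
  have : (nodes N).card ≤ N ^ 2 := by
    rw [nodes, Finset.card_product, sq]
    simp only [Int.card_Icc]
    exact Nat.mul_le_mul (by omega) (by omega)
  exact_mod_cast this

/-- Lemma 4.1, part (1) (short-range correlations, `d = 2`): under
the a priori bounds `|D⁻ₛG| ≤ Ch^{γ₁}`, `|D⁻ₛU^ε| ≤ Ch^{γ₂}`, `|G| ≤ Ch^{γ₃}`,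
`|U^ε| ≤ Ch^{γ₄}`, the discrete corrector satisfies
`E‖U^ε − U⁰‖²_{ℓ²} ≤ C′ h^{2 min(γ₁+γ₂, γ₃+γ₄) − 2} ‖R‖_{L¹} (ε/δ)²`, with `C′`
depending only on `C`. -/
theorem stmt14 (C : ℝ) (hC : 0 < C) :
    ∃ C' : ℝ, 0 < C' ∧
      ∀ (Ω : Type) [MeasureSpace Ω] [IsProbabilityMeasure (volume : Measure Ω)],
      ∀ (q : ℝ × ℝ → Ω → ℝ) (R : ℝ × ℝ → ℝ) (M : ℝ),
        Measurable (fun p : (ℝ × ℝ) × Ω => q p.1 p.2) →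
        (∀ x ω, |q x ω| ≤ M) →
        (∀ x, ∫ ω, q x ω = 0) →
        (∀ x y : ℝ × ℝ, ∫ ω, q x ω * q y ω = R (x - y)) →
        Integrable R →
      ∀ (N : ℕ), 0 < N → ∀ (h δ : ℝ), h = 1 / N → 0 < δ → δ ≤ h →
      ∀ (q₀ : ℝ × ℝ → ℝ), Measurable q₀ → (∃ M₀ : ℝ, ∀ x, |q₀ x| ≤ M₀) →
        (∀ x, 0 ≤ q₀ x) →
      ∀ (ε : ℝ), 0 < ε →
        (∀ᵐ ω ∂(volume : Measure Ω), ∀ᵐ x ∂(volume.restrict Ysq),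
          0 ≤ q₀ x + q (ε⁻¹ • x) ω) →
      ∀ (f : ℝ × ℝ → ℝ), Measurable f → (∃ Mf : ℝ, ∀ x, |f x| ≤ Mf) →
      ∀ (Uε : Ω → ℤ × ℤ → ℝ) (U0 : ℤ × ℤ → ℝ) (G : ℤ × ℤ → ℤ × ℤ → ℝ),
        (∀ ij, Measurable fun ω => Uε ω ij) →
        (∀ ω, ∀ kl, kl ∉ nodes N → Uε ω kl = 0) →
        (∀ kl, kl ∉ nodes N → U0 kl = 0) →
        (∀ ω, ∀ ij ∈ nodes N,
          ∑ kl ∈ nodes N,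
            stiff h δ N (fun x => q₀ x + q (ε⁻¹ • x) ω) ij kl * Uε ω kl = load h f ij) →
        (∀ ij ∈ nodes N, ∑ kl ∈ nodes N, stiff h δ N q₀ ij kl * U0 kl = load h f ij) →
        (∀ ij kl, (ij ∉ nodes N ∨ kl ∉ nodes N) → G ij kl = 0) →
        (∀ ij ∈ nodes N, ∀ mn ∈ nodes N,
          ∑ kl ∈ nodes N, G ij kl * stiff h δ N q₀ kl mn = if ij = mn then 1 else 0) →
      ∀ (γ₁ γ₂ γ₃ γ₄ : ℝ),
        (∀ ω, ∀ s : Fin 3, ∀ ij ∈ nodes N, ∀ kl ∈ nodes N,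
          |G ij kl - G ij (dm s kl)| ≤ C * h ^ γ₁ ∧
          |Uε ω ij - Uε ω (dm s ij)| ≤ C * h ^ γ₂ ∧
          |G ij kl| ≤ C * h ^ γ₃ ∧ |Uε ω ij| ≤ C * h ^ γ₄) →
        ∫ ω, ∑ ij ∈ nodes N, (Uε ω ij - U0 ij) ^ 2 ≤
          C' * h ^ (2 * min (γ₁ + γ₂) (γ₃ + γ₄) - 2) * (∫ z, |R z|) * (ε / δ) ^ 2 := by
  refine ⟨1024 * C ^ 4, by positivity, ?_⟩
  intro Ω _ _ q R M hq hM _ hR hRi N hN h δ hhN hδ hδh q₀ hq₀ hM₀ _ ε hε _ f _ _ Uε U0 G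
    _ _ _ hUε hU0 _ hG γ₁ γ₂ γ₃ γ₄ hb
  obtain ⟨M₀, hM₀⟩ := hM₀
  have hN1 : (1 : ℝ) ≤ N := by exact_mod_cast hN
  have hh : 0 < h := by rw [hhN]; positivity
  have hh1 : h ≤ 1 := by rw [hhN, div_le_one (by positivity)]; exact hN1
  have hNh : (N : ℝ) * h = 1 := by rw [hhN]; field_simp
  have hpt : ∀ ω, ∑ ij ∈ nodes N, (Uε ω ij - U0 ij) ^ 2 ≤
      (N : ℝ) ^ 2 * ((C * h ^ γ₃ * (C * h ^ γ₄)) ^ 2 * (32 * (N : ℝ) ^ 2)) *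
        massSq h δ N (fun x => q (ε⁻¹ • x) ω) := fun ω => by
    have hmass : 0 ≤ massSq h δ N (fun x => q (ε⁻¹ • x) ω) :=
      Finset.sum_nonneg fun _ _ => Finset.sum_nonneg fun _ _ => sq_nonneg _
    have hv : Measurable fun x => q (ε⁻¹ • x) ω :=
      hq.comp (f := fun x : ℝ × ℝ => (ε⁻¹ • x, ω)) (by fun_prop)
    refine (Finset.sum_le_card_nsmul _ _ _ fun i hi =>
      sq_sub_le_massSq hh hδ hδh N hq₀ hv hM₀ (fun x => hM _ ω) (hUε ω) hU0 hG
        (fun i hi k hk => (hb ω 0 i hi k hk).2.2.1)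
        (fun i hi => (hb ω 0 i hi i hi).2.2.2) hi).trans ?_
    rw [nsmul_eq_mul, mul_assoc ((N : ℝ) ^ 2), mul_assoc (_ ^ 2)]
    gcongr
    exact card_nodes_le N
  have hR0 : 0 ≤ ∫ z, |R z| := integral_nonneg fun _ => abs_nonneg _
  have hpow : (h ^ γ₃ * h ^ γ₄) ^ 2 * (N : ℝ) ^ 2 ≤
      h ^ (2 * min (γ₁ + γ₂) (γ₃ + γ₄) - 2) := by
    have hN2 : (N : ℝ) ^ 2 = h ^ (-2 : ℝ) := by
      rw [Real.rpow_neg hh.le, Real.rpow_two]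
      exact eq_inv_of_mul_eq_one_left (by rw [← mul_pow, hNh, one_pow])
    rw [hN2, ← Real.rpow_add hh, ← Real.rpow_mul_natCast hh.le, ← Real.rpow_add hh]
    refine Real.rpow_le_rpow_of_exponent_ge hh hh1 ?_
    have := min_le_right (γ₁ + γ₂) (γ₃ + γ₄)
    push_cast
    linarith
  calc ∫ ω, ∑ ij ∈ nodes N, (Uε ω ij - U0 ij) ^ 2
      ≤ ∫ ω, (N : ℝ) ^ 2 * ((C * h ^ γ₃ * (C * h ^ γ₄)) ^ 2 * (32 * (N : ℝ) ^ 2)) *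
        massSq h δ N (fun x => q (ε⁻¹ • x) ω) :=
        integral_mono_of_nonneg
          (ae_of_all _ fun ω => Finset.sum_nonneg fun _ _ => sq_nonneg _)
          ((integrable_massSq hq hM hh hδ hδh N).const_mul _) (ae_of_all _ hpt)
    _ ≤ (N : ℝ) ^ 2 * ((C * h ^ γ₃ * (C * h ^ γ₄)) ^ 2 * (32 * (N : ℝ) ^ 2)) *
        (32 * (N : ℝ) ^ 2 * (h ^ 4 * (∫ z, |R z|) * (ε / δ) ^ 2)) := by
        rw [integral_const_mul]
        gcongr
        exact integral_massSq_le hq hM hR hRi hh hδ hδh hε N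
    _ = 1024 * C ^ 4 * ((h ^ γ₃ * h ^ γ₄) ^ 2 * (N : ℝ) ^ 2) * (∫ z, |R z|) * (ε / δ) ^ 2 *
        ((N : ℝ) * h) ^ 4 := by ring
    _ = 1024 * C ^ 4 * ((h ^ γ₃ * h ^ γ₄) ^ 2 * (N : ℝ) ^ 2) * (∫ z, |R z|) * (ε / δ) ^ 2 := by
        rw [hNh, one_pow, mul_one]
    _ ≤ _ := by gcongr
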